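/- For all rational numbers m₁ and m₂, the value d(m₁,m₂) = 27m₁⁸+108m₁⁷m₂+486m₁⁶m₂²+1080m₁⁵m₂³+2457m₁⁴m₂⁴+3240m₁³m₂⁵+4374m₁²m₂⁶+2916m₁m₂⁷+2187m₂⁸−2916m₁⁶m₂−8748m₁⁵m₂²−34992m₁⁴m₂³−55404m₁³m₂⁴−104976m₁²m₂⁵−78732m₁m₂⁶−78732m₂⁷−105012m₁⁶−315036m₁⁵m₂−971388m₁⁴m₂²−1417716m₁³m₂³−1759140m₁²m₂⁴−1102788m₁m₂⁵−236520m₂⁶+48m₁⁵+1008m₁⁴m₂+3120m₁³m₂²+7056m₁²m₂³+8208m₁m₂⁴+6480m₂⁵+26168m₁⁴+23760m₁³m₂+69576m₁²m₂²−13104m₁m₂³−18792m₂⁴−1728m₁³+3888m₁²m₂+24624m₁m₂²−66096m₂³−1776m₁²+2064m₁m₂−720m₂²+448m₁+1344m₂+560 is nonzero; that is, the equation d(m₁,m₂) = 0 has no rational solutions. -/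

import Mathlib

/-- The polynomial `d(m₁, m₂)` of Section 4.3 of the paper. -/
def discSextic (m₁ m₂ : ℚ) : ℚ :=
  27*m₁^8 + 108*m₁^7*m₂ + 486*m₁^6*m₂^2 + 1080*m₁^5*m₂^3 + 2457*m₁^4*m₂^4
    + 3240*m₁^3*m₂^5 + 4374*m₁^2*m₂^6 + 2916*m₁*m₂^7 + 2187*m₂^8
    - 2916*m₁^6*m₂ - 8748*m₁^5*m₂^2 - 34992*m₁^4*m₂^3 - 55404*m₁^3*m₂^4
    - 104976*m₁^2*m₂^5 - 78732*m₁*m₂^6 - 78732*m₂^7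
    - 105012*m₁^6 - 315036*m₁^5*m₂ - 971388*m₁^4*m₂^2 - 1417716*m₁^3*m₂^3
    - 1759140*m₁^2*m₂^4 - 1102788*m₁*m₂^5 - 236520*m₂^6
    + 48*m₁^5 + 1008*m₁^4*m₂ + 3120*m₁^3*m₂^2 + 7056*m₁^2*m₂^3
    + 8208*m₁*m₂^4 + 6480*m₂^5
    + 26168*m₁^4 + 23760*m₁^3*m₂ + 69576*m₁^2*m₂^2 - 13104*m₁*m₂^3
    - 18792*m₂^4
    - 1728*m₁^3 + 3888*m₁^2*m₂ + 24624*m₁*m₂^2 - 66096*m₂^3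
    - 1776*m₁^2 + 2064*m₁*m₂ - 720*m₂^2 + 448*m₁ + 1344*m₂ + 560

/-- The degree-8 homogenization of `discSextic`, over the integers. -/
def discForm (x y z : ℤ) : ℤ :=
    27*x^8 + 108*x^7*y + 486*x^6*y^2 + 1080*x^5*y^3 + 2457*x^4*y^4 + 3240*x^3*y^5
    + 4374*x^2*y^6 + 2916*x*y^7 + 2187*y^8 - 2916*x^6*y*z - 8748*x^5*y^2*z - 34992*x^4*y^3*z
    - 55404*x^3*y^4*z - 104976*x^2*y^5*z - 78732*x*y^6*z - 78732*y^7*z - 105012*x^6*z^2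
    - 315036*x^5*y*z^2 - 971388*x^4*y^2*z^2 - 1417716*x^3*y^3*z^2 - 1759140*x^2*y^4*z^2
    - 1102788*x*y^5*z^2 - 236520*y^6*z^2 + 48*x^5*z^3 + 1008*x^4*y*z^3 + 3120*x^3*y^2*z^3
    + 7056*x^2*y^3*z^3 + 8208*x*y^4*z^3 + 6480*y^5*z^3 + 26168*x^4*z^4 + 23760*x^3*y*z^4
    + 69576*x^2*y^2*z^4 - 13104*x*y^3*z^4 - 18792*y^4*z^4 - 1728*x^3*z^5 + 3888*x^2*y*z^5
    + 24624*x*y^2*z^5 - 66096*y^3*z^5 - 1776*x^2*z^6 + 2064*x*y*z^6 - 720*y^2*z^6 + 448*x*z^7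
    + 1344*y*z^7 + 560*z^8

/-- The quotient of `discForm (2 * x) (2 * y) z` by `16`. -/
def discFormHalved (x y z : ℤ) : ℤ :=
    432*x^8 + 1728*x^7*y + 7776*x^6*y^2 + 17280*x^5*y^3 + 39312*x^4*y^4 + 51840*x^3*y^5
    + 69984*x^2*y^6 + 46656*x*y^7 + 34992*y^8 - 23328*x^6*y*z - 69984*x^5*y^2*z
    - 279936*x^4*y^3*z - 443232*x^3*y^4*z - 839808*x^2*y^5*z - 629856*x*y^6*z - 629856*y^7*z
    - 420048*x^6*z^2 - 1260144*x^5*y*z^2 - 3885552*x^4*y^2*z^2 - 5670864*x^3*y^3*z^2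
    - 7036560*x^2*y^4*z^2 - 4411152*x*y^5*z^2 - 946080*y^6*z^2 + 96*x^5*z^3 + 2016*x^4*y*z^3
    + 6240*x^3*y^2*z^3 + 14112*x^2*y^3*z^3 + 16416*x*y^4*z^3 + 12960*y^5*z^3 + 26168*x^4*z^4
    + 23760*x^3*y*z^4 + 69576*x^2*y^2*z^4 - 13104*x*y^3*z^4 - 18792*y^4*z^4 - 864*x^3*z^5
    + 1944*x^2*y*z^5 + 12312*x*y^2*z^5 - 33048*y^3*z^5 - 444*x^2*z^6 + 516*x*y*z^6
    - 180*y^2*z^6 + 56*x*z^7 + 168*y*z^7 + 35*z^8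

lemma discForm_two_mul (x y z : ℤ) :
    discForm (2 * x) (2 * y) z = 16 * discFormHalved x y z := by
  unfold discForm discFormHalved
  ring

lemma discForm_mul_left (k x y z : ℤ) :
    discForm (k * x) (k * y) (k * z) = k ^ 8 * discForm x y z := by
  unfold discForm
  ring

lemma even_of_even_discForm {x y z : ℤ} (h : Even (discForm x y z)) : Even x ∧ Even y := by
  simp only [← ZMod.intCast_eq_zero_iff_even] at h ⊢
  unfold discForm at h
  push_cast at h
  generalize (x : ZMod 2) = a, (y : ZMod 2) = b, (z : ZMod 2) = c at *
  reduce_mod_char at h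
  revert a b
  decide

lemma even_of_even_discFormHalved {x y z : ℤ} (h : Even (discFormHalved x y z)) : Even z := by
  simp only [← ZMod.intCast_eq_zero_iff_even] at h ⊢
  unfold discFormHalved at h
  push_cast at h
  generalize (x : ZMod 2) = a, (y : ZMod 2) = b, (z : ZMod 2) = c at *
  reduce_mod_char at h
  revert c
  decide

lemma exists_eq_two_mul_of_discForm_eq_zero {x y z : ℤ} (h : discForm x y z = 0) :
    ∃ x' y' z' : ℤ, x = 2 * x' ∧ y = 2 * y' ∧ z = 2 * z' := by
  obtain ⟨hx, hy⟩ := even_of_even_discForm (h ▸ Even.zero : Even (discForm x y z))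
  obtain ⟨a, rfl⟩ := hx.two_dvd
  obtain ⟨b, rfl⟩ := hy.two_dvd
  rw [discForm_two_mul] at h
  have hG : discFormHalved a b z = 0 := by omega
  have hz := even_of_even_discFormHalved (hG ▸ Even.zero : Even (discFormHalved a b z))
  obtain ⟨c, rfl⟩ := hz.two_dvd
  exact ⟨a, b, c, rfl, rfl, rfl⟩

/-- A zero of `discForm` can be halved indefinitely, so its last coordinate vanishes. -/
lemma eq_zero_of_discForm_eq_zero {x y z : ℤ} (h : discForm x y z = 0) : z = 0 := by
  induction hn : z.natAbs using Nat.strong_induction_on generalizing x y z with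
  | _ n ih =>
    obtain ⟨a, b, c, rfl, rfl, rfl⟩ := exists_eq_two_mul_of_discForm_eq_zero h
    rw [discForm_mul_left] at h
    have h' : discForm a b c = 0 := by omega
    by_contra hc
    have := ih c.natAbs (by omega) h' rfl
    omega

lemma discForm_cast (x y z : ℤ) (hz : z ≠ 0) :
    (discForm x y z : ℚ) = z ^ 8 * discSextic (x / z) (y / z) := by
  have hz' : (z : ℚ) ≠ 0 := by exact_mod_cast hz
  unfold discForm discSextic
  push_cast
  field_simp

/-- `d(m₁, m₂) = 0` has no rational solutions (Section 4.3 of the paper). -/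
theorem stmt_15 (m₁ m₂ : ℚ) : discSextic m₁ m₂ ≠ 0 := by
  intro h
  have h₁ : (m₁.den : ℚ) ≠ 0 := by exact_mod_cast m₁.den_nz
  have h₂ : (m₂.den : ℚ) ≠ 0 := by exact_mod_cast m₂.den_nz
  have hz : (m₁.den * m₂.den : ℤ) ≠ 0 := by exact_mod_cast mul_ne_zero m₁.den_nz m₂.den_nz
  have hm₁ : ((m₁.num * m₂.den : ℤ) : ℚ) / (m₁.den * m₂.den : ℤ) = m₁ := by
    push_cast
    rw [mul_div_mul_right _ _ h₂, Rat.num_div_den]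
  have hm₂ : ((m₁.den * m₂.num : ℤ) : ℚ) / (m₁.den * m₂.den : ℤ) = m₂ := by
    push_cast
    rw [mul_div_mul_left _ _ h₁, Rat.num_div_den]
  have key := discForm_cast (m₁.num * m₂.den) (m₁.den * m₂.num) _ hz
  rw [hm₁, hm₂, h, mul_zero] at key
  exact hz (eq_zero_of_discForm_eq_zero (by exact_mod_cast key))
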